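/- Let d ≥ 1, s ∈ [1/2, 1) and L₀ ≥ 2. Let u : ℝ^d → ℝ be Lipschitz on the unit ball B₁ with |u| ≤ 1 on B₁ and ‖∇u‖_{L^∞(B₁)} ≤ L₀. Then ∬_{B₁×B₁} |u(x)−u(y)|² / |x−y|^{d+2s} dx dy ≤ (1/(1−s)) · d·ω_d · L₀^{2s−1} · ((2−2s)·log(2L₀) + 1) · ∫_{B₁} |∇u(x)| dx, where ω_d is the volume of the unit ball in ℝ^d. -/

import Mathlib

open MeasureTheory Metric Set

lemma aux_line {E : Type*} [NormedAddCommGroup E] [NormedSpace ℝ E]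
    (g : E → ℝ) (C : NNReal) (hg : LipschitzWith C g) (x h : E)
    (hae : ∀ᵐ t : ℝ, DifferentiableAt ℝ g (x + t • h)) :
    ‖g (x + h) - g x‖ₑ ≤ ∫⁻ t in Ioc (0:ℝ) 1, ‖fderiv ℝ g (x + t • h)‖ₑ * ‖h‖ₑ := by
  have hl : LipschitzWith (C * ‖h‖₊) (fun t : ℝ => g (x + t • h)) := by
    refine hg.comp (LipschitzWith.of_dist_le_mul fun a b => ?_)
    rw [dist_add_left, dist_eq_norm, dist_eq_norm, ← sub_smul, norm_smul, mul_comm]; rfl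
  have hac := (hl.lipschitzOnWith (s := uIcc 0 1)).absolutelyContinuousOnInterval
  have := hac.integral_deriv_eq_sub
  simp only [one_smul, zero_smul, add_zero] at this
  rw [← this, intervalIntegral.integral_of_le zero_le_one]
  refine (enorm_integral_le_lintegral_enorm _).trans (lintegral_mono_ae ?_)
  filter_upwards [ae_restrict_of_ae hae] with t ht
  have h1 : HasDerivAt (fun t : ℝ => x + t • h) h t := by
    simpa using ((hasDerivAt_id t).smul_const h).const_add x
  have h2 := ht.hasFDerivAt.comp_hasDerivAt t h1
  have h3 : deriv (fun t : ℝ => g (x + t • h)) t = fderiv ℝ g (x + t • h) h := h2.deriv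
  rw [h3]
  exact (fderiv ℝ g (x + t • h)).le_opENorm h

lemma aux_trans {d : ℕ} (g : EuclideanSpace ℝ (Fin d) → ℝ) (C : NNReal) (hg : LipschitzWith C g)
    (h : EuclideanSpace ℝ (Fin d)) :
    ∫⁻ x, (ball (0 : EuclideanSpace ℝ (Fin d)) 1 ∩ (fun x => x + h) ⁻¹' ball 0 1).indicator
      (fun x => ‖g (x + h) - g x‖ₑ) x ≤
    ‖h‖ₑ * ∫⁻ x in ball (0 : EuclideanSpace ℝ (Fin d)) 1, ‖fderiv ℝ g x‖ₑ := by
  set B := ball (0 : EuclideanSpace ℝ (Fin d)) 1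
  have hB : MeasurableSet B := measurableSet_ball
  have hm : Measurable (fun x => ‖fderiv ℝ g x‖ₑ) := (measurable_fderiv ℝ g).enorm
  have hdiff := hg.ae_differentiableAt (μ := volume)
  have hae : ∀ᵐ x : EuclideanSpace ℝ (Fin d), ∀ᵐ t : ℝ, DifferentiableAt ℝ g (x + t • h) := by
    have hS : MeasurableSet {p : ℝ × EuclideanSpace ℝ (Fin d) |
        DifferentiableAt ℝ g (p.2 + p.1 • h)} :=
      (show Measurable (fun p : ℝ × EuclideanSpace ℝ (Fin d) => p.2 + p.1 • h) by fun_prop)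
        (measurableSet_of_differentiableAt ℝ g)
    refine (Measure.ae_ae_comm hS).1 (Filter.Eventually.of_forall fun t => ?_)
    exact (measurePreserving_add_right volume (t • h)).quasiMeasurePreserving.ae hdiff
  calc _ ≤ ∫⁻ x, ∫⁻ t in Ioc (0:ℝ) 1, B.indicator (fun x => ‖fderiv ℝ g x‖ₑ) (x + t • h) * ‖h‖ₑ := by
        refine lintegral_mono_ae ?_
        filter_upwards [hae] with x hx
        by_cases hxB : x ∈ B ∩ (fun x => x + h) ⁻¹' B
        · rw [indicator_of_mem hxB]
          refine (aux_line g C hg x h hx).trans ?_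
          refine setLIntegral_mono' measurableSet_Ioc fun t ht => ?_
          have : x + t • h ∈ B := by
            have := (convex_ball (0 : EuclideanSpace ℝ (Fin d)) 1).add_smul_mem hxB.1 hxB.2
              ⟨ht.1.le, ht.2⟩
            exact this
          rw [indicator_of_mem this]
        · rw [indicator_of_notMem hxB]; exact zero_le
    _ = ∫⁻ t in Ioc (0:ℝ) 1, ∫⁻ x, B.indicator (fun x => ‖fderiv ℝ g x‖ₑ) (x + t • h) * ‖h‖ₑ := by
        refine lintegral_lintegral_swap (Measurable.aemeasurable ?_)
        refine Measurable.mul_const ((hm.indicator hB).comp ?_) _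
        fun_prop
    _ = ∫⁻ t in Ioc (0:ℝ) 1, ‖h‖ₑ * ∫⁻ x in B, ‖fderiv ℝ g x‖ₑ := by
        refine lintegral_congr fun t => ?_
        rw [lintegral_add_right_eq_self (fun x => B.indicator (fun x => ‖fderiv ℝ g x‖ₑ) x * ‖h‖ₑ) (t • h),
          lintegral_mul_const _ (hm.indicator hB), lintegral_indicator hB, mul_comm]
    _ = _ := by simp

noncomputable def psiF (s L r : ℝ) : ℝ :=
  if r < 1 / L then L * r ^ (1 - 2 * s) else if r < 2 then 2 * L ^ (2 * s - 1) * r⁻¹ else 0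

lemma psiF_int (s L : ℝ) (hs1 : s < 1) (hs : 1/2 ≤ s) (hL : 2 ≤ L) :
    IntegrableOn (psiF s L) (Ioi 0) ∧ ∫ r in Ioi 0, psiF s L r =
      L ^ (2 * s - 1) / (2 * (1 - s)) + 2 * L ^ (2 * s - 1) * Real.log (2 * L) := by
  have hL0 : 0 < L := by linarith
  have hL1 : 0 < 1 / L := by positivity
  have hL2 : 1 / L ≤ 2 := by rw [div_le_iff₀ hL0]; linarith
  have e : Ioi (0:ℝ) = (Ioo 0 (1/L) ∪ Ico (1/L) 2) ∪ Ici 2 := by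
    rw [Ioo_union_Ico_eq_Ioo hL1 hL2, Ioo_union_Ici_eq_Ioi (by norm_num)]
  have c1 : EqOn (psiF s L) (fun r => L * r ^ (1 - 2 * s)) (Ioo 0 (1/L)) := by
    intro r hr; simp only [psiF]; rw [if_pos hr.2]
  have c2 : EqOn (psiF s L) (fun r => 2 * L ^ (2 * s - 1) * r⁻¹) (Ico (1/L) 2) := by
    intro r hr; simp only [psiF]; rw [if_neg hr.1.not_gt, if_pos hr.2]
  have c3 : EqOn (psiF s L) (fun r => 0) (Ici 2) := by
    intro r hr; simp only [psiF]; rw [if_neg (hL2.trans hr).not_gt, if_neg (not_lt.2 hr)]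
  have i1 : IntegrableOn (psiF s L) (Ioo 0 (1/L)) := by
    rw [integrableOn_congr_fun c1 measurableSet_Ioo, ← integrableOn_Ioc_iff_integrableOn_Ioo,
      ← intervalIntegrable_iff_integrableOn_Ioc_of_le hL1.le]
    exact (intervalIntegral.intervalIntegrable_rpow' (by linarith)).const_mul _
  have i2 : IntegrableOn (psiF s L) (Ico (1/L) 2) := by
    rw [integrableOn_congr_fun c2 measurableSet_Ico, integrableOn_Ico_iff_integrableOn_Ioo,
      ← integrableOn_Ioc_iff_integrableOn_Ioo,
      ← intervalIntegrable_iff_integrableOn_Ioc_of_le hL2]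
    refine (intervalIntegral.intervalIntegrable_inv (fun x hx => ?_) continuousOn_id).const_mul _
    rw [uIcc_of_le hL2] at hx
    exact (hL1.trans_le hx.1).ne'
  have i3 : IntegrableOn (psiF s L) (Ici 2) := by
    rw [integrableOn_congr_fun c3 measurableSet_Ici]; exact integrableOn_zero
  have d1 : Disjoint (Ioo 0 (1/L)) (Ico (1/L) 2) :=
    Set.disjoint_left.2 fun r h1 h2 => h2.1.not_gt h1.2
  have d2 : Disjoint (Ioo 0 (1/L) ∪ Ico (1/L) 2) (Ici 2) := by
    rw [Ioo_union_Ico_eq_Ioo hL1 hL2]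
    exact Set.disjoint_left.2 fun r h1 h2 => h1.2.not_ge h2
  rw [e]
  refine ⟨(i1.union i2).union i3, ?_⟩
  rw [setIntegral_union d2 measurableSet_Ici (i1.union i2) i3,
    setIntegral_union d1 measurableSet_Ico i1 i2, setIntegral_congr_fun measurableSet_Ioo c1,
    setIntegral_congr_fun measurableSet_Ico c2, setIntegral_congr_fun measurableSet_Ici c3,
    integral_Ico_eq_integral_Ioo, ← integral_Ioc_eq_integral_Ioo, ← integral_Ioc_eq_integral_Ioo,
    ← intervalIntegral.integral_of_le hL1.le, ← intervalIntegral.integral_of_le hL2,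
    intervalIntegral.integral_const_mul, intervalIntegral.integral_const_mul,
    integral_rpow (Or.inl (by linarith)), integral_inv_of_pos hL1 (by norm_num)]
  have e1 : (2:ℝ) / (1 / L) = 2 * L := by field_simp
  have e2 : (1 / L) ^ (1 - 2 * s + 1) = L ^ (2 * s - 1) / L := by
    rw [one_div, Real.inv_rpow hL0.le, ← Real.rpow_neg hL0.le, ← Real.rpow_sub_one hL0.ne']
    congr 1; ring
  rw [e1, e2, Real.zero_rpow (by linarith)]
  have : 1 - s ≠ 0 := by linarith
  have h2 : 1 - 2 * s + 1 = 2 * (1 - s) := by ring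
  rw [h2]
  simp only [integral_zero, add_zero, sub_zero]
  field_simp

lemma psiF_nonneg (s L r : ℝ) (hL : 0 < L) (hr : 0 ≤ r) : 0 ≤ psiF s L r := by
  unfold psiF; split_ifs <;> positivity

lemma psiF_bound (s L r a : ℝ) (hs : 1/2 ≤ s) (hL : 2 ≤ L) (hr : 0 < r) (hr2 : r < 2) (ha : 0 ≤ a)
    (ha2 : a ≤ 2) (haL : a ≤ L * r) (d : ℕ) (hd : 1 ≤ d) :
    a ^ 2 / r ^ ((d:ℝ) + 2 * s) ≤ psiF s L r / r ^ (d - 1) * (r⁻¹ * a) := by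
  have hL0 : 0 < L := by linarith
  have e : r ^ ((d:ℝ) + 2 * s) = r ^ (d - 1) * r * r ^ (2 * s) := by
    rw [Real.rpow_add hr, Real.rpow_natCast, ← pow_succ]; congr 3; omega
  have key : a * r ^ (- (2 * s)) ≤ psiF s L r := by
    have hp : 0 < r ^ (-(2*s)) := Real.rpow_pos_of_pos hr _
    unfold psiF
    split_ifs with h
    · rw [show 1 - 2 * s = 1 + -(2*s) by ring, Real.rpow_add hr, Real.rpow_one, ← mul_assoc]
      gcongr
    · rw [show -(2 * s) = -1 + -(2 * s - 1) by ring, Real.rpow_add hr, Real.rpow_neg_one,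
        Real.rpow_neg hr.le, ← Real.inv_rpow hr.le]
      have : r⁻¹ ^ (2 * s - 1) ≤ L ^ (2 * s - 1) := by
        refine Real.rpow_le_rpow (by positivity) ?_ (by linarith)
        rw [inv_le_comm₀ hr hL0, ← one_div]; exact not_lt.1 h
      calc a * (r⁻¹ * r⁻¹ ^ (2 * s - 1)) ≤ 2 * (r⁻¹ * L ^ (2 * s - 1)) := by gcongr
        _ = _ := by ring
  calc a ^ 2 / r ^ ((d:ℝ) + 2 * s) = a * r ^ (-(2 * s)) / r ^ (d - 1) * (r⁻¹ * a) := by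
        rw [e, Real.rpow_neg hr.le]; field_simp
    _ ≤ _ := by gcongr

lemma aux_polar (d : ℕ) (hd : 1 ≤ d) (s L : ℝ) (hs1 : s < 1) (hs : 1/2 ≤ s) (hL : 2 ≤ L) :
    ∫⁻ h : EuclideanSpace ℝ (Fin d), ENNReal.ofReal (psiF s L ‖h‖ / ‖h‖ ^ (d - 1)) =
    ENNReal.ofReal (d * (volume (ball (0 : EuclideanSpace ℝ (Fin d)) 1)).toReal *
      (L ^ (2 * s - 1) / (2 * (1 - s)) + 2 * L ^ (2 * s - 1) * Real.log (2 * L))) := by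
  have : Nonempty (Fin d) := ⟨⟨0, hd⟩⟩
  obtain ⟨hi, hI⟩ := psiF_int s L hs1 hs hL
  have c : EqOn (fun y : ℝ => y ^ (d - 1) • (psiF s L y / y ^ (d - 1))) (psiF s L) (Ioi 0) := by
    intro y hy
    have : y ^ (d - 1) ≠ 0 := pow_ne_zero _ (ne_of_gt hy)
    simp only [smul_eq_mul]; field_simp
  have hint : Integrable (fun h : EuclideanSpace ℝ (Fin d) => psiF s L ‖h‖ / ‖h‖ ^ (d - 1)) := by
    rw [integrable_fun_norm_addHaar volume (f := fun r => psiF s L r / r ^ (d - 1)),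
      finrank_euclideanSpace_fin]
    rwa [integrableOn_congr_fun c measurableSet_Ioi]
  rw [← ofReal_integral_eq_lintegral_ofReal hint]
  · rw [integral_fun_norm_addHaar volume (fun r => psiF s L r / r ^ (d - 1)),
      finrank_euclideanSpace_fin, setIntegral_congr_fun measurableSet_Ioi c, hI, nsmul_eq_mul,
      smul_eq_mul, ← mul_assoc]; rfl
  · refine Filter.Eventually.of_forall fun h => div_nonneg (psiF_nonneg _ _ _ (by linarith) (norm_nonneg _)) (by positivity)

lemma aux_main (d : ℕ) (hd : 1 ≤ d) (s L₀ : ℝ) (hs : 1/2 ≤ s) (hs1 : s < 1) (hL : 2 ≤ L₀)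
    (u : EuclideanSpace ℝ (Fin d) → ℝ)
    (hLip : LipschitzWith (Real.toNNReal L₀) u)
    (hub : ∀ x ∈ ball (0 : EuclideanSpace ℝ (Fin d)) 1, |u x| ≤ 1) :
    (∫⁻ p : EuclideanSpace ℝ (Fin d) × EuclideanSpace ℝ (Fin d) in
        (ball (0 : EuclideanSpace ℝ (Fin d)) 1) ×ˢ (ball (0 : EuclideanSpace ℝ (Fin d)) 1),
        ENNReal.ofReal ((u p.1 - u p.2)^2 / ‖p.1 - p.2‖ ^ ((d : ℝ) + 2*s))) ≤
      ENNReal.ofReal ((1/(1-s)) * d *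
        (volume (ball (0 : EuclideanSpace ℝ (Fin d)) 1)).toReal * L₀ ^ (2*s - 1) *
        ((2 - 2*s) * Real.log (2*L₀) + 1) *
        ∫ x in ball (0 : EuclideanSpace ℝ (Fin d)) 1, ‖fderiv ℝ u x‖) := by
  have hL0 : 0 < L₀ := by linarith
  set B := ball (0 : EuclideanSpace ℝ (Fin d)) 1 with hBdef
  have hB : MeasurableSet B := measurableSet_ball
  have hu : Measurable u := hLip.continuous.measurable
  set F : EuclideanSpace ℝ (Fin d) × EuclideanSpace ℝ (Fin d) → ENNReal := fun p =>
    ENNReal.ofReal ((u p.1 - u p.2)^2 / ‖p.1 - p.2‖ ^ ((d : ℝ) + 2*s)) with hF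
  have hFm : Measurable F := by
    rw [hF]; fun_prop
  have hFi : Measurable ((B ×ˢ B).indicator F) := hFm.indicator (hB.prod hB)
  have hG : ENNReal.ofReal (∫ x in B, ‖fderiv ℝ u x‖) = ∫⁻ x in B, ‖fderiv ℝ u x‖ₑ := by
    rw [ofReal_integral_eq_lintegral_ofReal]
    · simp only [ofReal_norm]
    · refine Measure.integrableOn_of_bounded (M := L₀) measure_ball_lt_top.ne
        (measurable_fderiv ℝ u).norm.aestronglyMeasurable ?_
      refine Filter.Eventually.of_forall fun x => ?_
      rw [norm_norm]
      simpa [hL0.le] using norm_fderiv_le_of_lipschitz ℝ hLip (x₀ := x)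
    · exact Filter.Eventually.of_forall fun x => norm_nonneg _
  calc ∫⁻ p in B ×ˢ B, F p = ∫⁻ p, (B ×ˢ B).indicator F p := by
        rw [lintegral_indicator (hB.prod hB)]
    _ = ∫⁻ x, ∫⁻ y, (B ×ˢ B).indicator F (x, y) := by
        rw [Measure.volume_eq_prod, lintegral_prod _ hFi.aemeasurable]
    _ = ∫⁻ x, ∫⁻ h, (B ×ˢ B).indicator F (x, x + h) := by
        refine lintegral_congr fun x => ?_
        rw [lintegral_add_left_eq_self (fun y => (B ×ˢ B).indicator F (x, y)) x]
    _ = ∫⁻ h, ∫⁻ x, (B ×ˢ B).indicator F (x, x + h) := by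
        refine lintegral_lintegral_swap (Measurable.aemeasurable ?_)
        refine hFi.comp ?_
        fun_prop
    _ ≤ ∫⁻ h, ENNReal.ofReal (psiF s L₀ ‖h‖ / ‖h‖ ^ (d - 1)) * ∫⁻ x in B, ‖fderiv ℝ u x‖ₑ := by
        refine lintegral_mono fun h => ?_
        by_cases h0 : h = 0
        · have : ∫⁻ x, (B ×ˢ B).indicator F (x, x + h) = 0 := by
            rw [← lintegral_zero (μ := (volume : Measure (EuclideanSpace ℝ (Fin d))))]
            refine lintegral_congr fun x => ?_
            simp [hF, h0, indicator]
          rw [this]; exact zero_le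
        have hn : 0 < ‖h‖ := norm_pos_iff.2 h0
        have hψ : 0 ≤ psiF s L₀ ‖h‖ / ‖h‖ ^ (d - 1) :=
          div_nonneg (psiF_nonneg _ _ _ hL0 hn.le) (by positivity)
        calc _ ≤ ∫⁻ x, ENNReal.ofReal (psiF s L₀ ‖h‖ / ‖h‖ ^ (d - 1) * ‖h‖⁻¹) *
              (B ∩ (fun x => x + h) ⁻¹' B).indicator (fun x => ‖u (x + h) - u x‖ₑ) x := by
              refine lintegral_mono fun x => ?_
              by_cases hx : x ∈ B ∩ (fun x => x + h) ⁻¹' B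
              · have hx2 : (x, x + h) ∈ B ×ˢ B := ⟨hx.1, hx.2⟩
                rw [indicator_of_mem hx2, indicator_of_mem hx, ← ofReal_norm,
                  ← ENNReal.ofReal_mul (by positivity), hF]
                refine ENNReal.ofReal_le_ofReal ?_
                have h1 := hub _ hx.1
                have h2 := hub _ hx.2
                simp only at h2
                have hlt : ‖h‖ < 2 := by
                  have := mem_ball_zero_iff.1 hx.1
                  have h3 : ‖x + h‖ < 1 := mem_ball_zero_iff.1 hx.2
                  calc ‖h‖ = ‖(x + h) - x‖ := by simp
                    _ ≤ ‖x + h‖ + ‖x‖ := norm_sub_le _ _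
                    _ < 2 := by linarith
                have hl : ‖u (x + h) - u x‖ ≤ L₀ * ‖h‖ := by
                  have := hLip.norm_sub_le (x + h) x
                  simpa [hL0.le] using this
                have hb : ‖u (x + h) - u x‖ ≤ 2 := by
                  refine (norm_sub_le _ _).trans ?_
                  simp only [Real.norm_eq_abs]; linarith
                have := psiF_bound s L₀ ‖h‖ _ hs hL hn hlt (norm_nonneg _) hb hl d hd
                rw [mul_assoc]
                refine le_trans (le_of_eq ?_) this
                rw [Real.norm_eq_abs (u _ - _), sq_abs]
                simp only [sub_add_cancel_left, norm_neg]
                ring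
              · have hx2 : (x, x + h) ∉ B ×ˢ B := fun hh => hx ⟨hh.1, hh.2⟩
                rw [indicator_of_notMem hx2]; exact zero_le
          _ = ENNReal.ofReal (psiF s L₀ ‖h‖ / ‖h‖ ^ (d - 1) * ‖h‖⁻¹) * ∫⁻ x,
              (B ∩ (fun x => x + h) ⁻¹' B).indicator (fun x => ‖u (x + h) - u x‖ₑ) x :=
              lintegral_const_mul' _ _ ENNReal.ofReal_ne_top
          _ ≤ ENNReal.ofReal (psiF s L₀ ‖h‖ / ‖h‖ ^ (d - 1) * ‖h‖⁻¹) *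
              (‖h‖ₑ * ∫⁻ x in B, ‖fderiv ℝ u x‖ₑ) := by
              gcongr; exact aux_trans u _ hLip h
          _ = _ := by
              rw [← mul_assoc, ← ofReal_norm h, ← ENNReal.ofReal_mul (by positivity), mul_assoc,
                inv_mul_cancel₀ hn.ne', mul_one]
    _ = ENNReal.ofReal (d * (volume B).toReal *
      (L₀ ^ (2 * s - 1) / (2 * (1 - s)) + 2 * L₀ ^ (2 * s - 1) * Real.log (2 * L₀))) *
        ENNReal.ofReal (∫ x in B, ‖fderiv ℝ u x‖) := by
        rw [lintegral_mul_const', aux_polar d hd s L₀ hs1 hs hL, hG]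
        rw [← hG]; exact ENNReal.ofReal_ne_top
    _ ≤ _ := by
        have h1s : 0 < 1 - s := by linarith
        have hlog : 0 ≤ Real.log (2 * L₀) := Real.log_nonneg (by linarith)
        rw [← ENNReal.ofReal_mul (by positivity)]
        refine ENNReal.ofReal_le_ofReal ?_
        refine mul_le_mul_of_nonneg_right ?_ (integral_nonneg fun x => norm_nonneg _)
        have : 1 / (1 - s) * d * (volume B).toReal * L₀ ^ (2*s - 1) *
          ((2 - 2*s) * Real.log (2*L₀) + 1) = d * (volume B).toReal *
          (L₀ ^ (2 * s - 1) / (1 - s) + 2 * L₀ ^ (2 * s - 1) * Real.log (2 * L₀)) := by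
          field_simp; ring
        rw [this]
        gcongr
        linarith

/-- Let `d ≥ 1`, `s ∈ [1/2, 1)` and `L₀ ≥ 2`. Let `u : ℝ^d → ℝ` be Lipschitz
on the unit ball `B₁` with `|u| ≤ 1` on `B₁` and `‖∇u‖_{L^∞(B₁)} ≤ L₀`. Then
`∬_{B₁×B₁} |u(x)−u(y)|²/|x−y|^{d+2s} ≤ (1/(1−s))·d·ω_d·L₀^{2s−1}·((2−2s)·log(2L₀)+1)·∫_{B₁}|∇u|`. -/
theorem stmt0 (d : ℕ) (hd : 1 ≤ d) (s L₀ : ℝ) (hs : 1/2 ≤ s) (hs1 : s < 1) (hL : 2 ≤ L₀)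
    (u : EuclideanSpace ℝ (Fin d) → ℝ)
    (hLip : LipschitzOnWith (Real.toNNReal L₀) u (ball (0 : EuclideanSpace ℝ (Fin d)) 1))
    (hub : ∀ x ∈ ball (0 : EuclideanSpace ℝ (Fin d)) 1, |u x| ≤ 1)
    (hgrad : ∀ᵐ x ∂(volume.restrict (ball (0 : EuclideanSpace ℝ (Fin d)) 1)),
      ‖fderiv ℝ u x‖ ≤ L₀) :
    (∫⁻ p : EuclideanSpace ℝ (Fin d) × EuclideanSpace ℝ (Fin d) in
        (ball (0 : EuclideanSpace ℝ (Fin d)) 1) ×ˢ (ball (0 : EuclideanSpace ℝ (Fin d)) 1),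
        ENNReal.ofReal ((u p.1 - u p.2)^2 / ‖p.1 - p.2‖ ^ ((d : ℝ) + 2*s))) ≤
      ENNReal.ofReal ((1/(1-s)) * d *
        (volume (ball (0 : EuclideanSpace ℝ (Fin d)) 1)).toReal * L₀ ^ (2*s - 1) *
        ((2 - 2*s) * Real.log (2*L₀) + 1) *
        ∫ x in ball (0 : EuclideanSpace ℝ (Fin d)) 1, ‖fderiv ℝ u x‖) := by
  obtain ⟨g, hg, hgu⟩ := hLip.extend_real
  have hfd : ∀ x ∈ ball (0 : EuclideanSpace ℝ (Fin d)) 1, fderiv ℝ u x = fderiv ℝ g x := by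
    intro x hx
    refine Filter.EventuallyEq.fderiv_eq ?_
    filter_upwards [isOpen_ball.mem_nhds hx] with y hy using hgu hy
  have := aux_main d hd s L₀ hs hs1 hL g hg (fun x hx => by rw [← hgu hx]; exact hub x hx)
  have e1 : ∫ x in ball (0 : EuclideanSpace ℝ (Fin d)) 1, ‖fderiv ℝ u x‖ =
      ∫ x in ball (0 : EuclideanSpace ℝ (Fin d)) 1, ‖fderiv ℝ g x‖ :=
    setIntegral_congr_fun measurableSet_ball fun x hx => by simp only [hfd x hx]
  rw [e1]
  refine le_trans (le_of_eq ?_) this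
  refine setLIntegral_congr_fun (measurableSet_ball.prod measurableSet_ball) fun p hp => ?_
  simp only [hgu hp.1, hgu hp.2]
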